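/- Fix integers l ≥ 1 and e ≥ 2. Let s ∈ ℤ^l with s_1 ≤ s_2 ≤ … ≤ s_l, let λ be an l-partition whose s-symbol B_s(λ) is semistandard, and let i ∈ {0,…,e−1}. If λ has a good addable i-node γ, then the s-symbol of the l-partition obtained from λ by adding γ is semistandard; and if λ has a good removable i-node γ, then the s-symbol of the l-partition obtained from λ by removing γ is semistandard. -/

import Mathlib

namespace FockCrystal

/-- A partition: `part a` is the `a`-th part, for `a ≥ 1`; `part 0` is a dummy value `0`. -/
structure Partition where
  part : ℕ → ℕ
  part_zero : part 0 = 0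
  antitone : ∀ a : ℕ, 1 ≤ a → part (a + 1) ≤ part a
  eventually_zero : ∃ N : ℕ, ∀ a : ℕ, N ≤ a → part a = 0

/-- A multipartition with `l + 1` components. -/
abbrev MultiPartition (l : ℕ) := Fin (l + 1) → Partition

/-- A node `(a, b, c)`: row `a ≥ 1`, column `b ≥ 1`, component `c`. -/
structure Node (l : ℕ) where
  row : ℕ
  col : ℕ
  comp : Fin (l + 1)

variable {l : ℕ}

def IsNode (Λ : MultiPartition l) (γ : Node l) : Prop :=
  1 ≤ γ.row ∧ 1 ≤ γ.col ∧ γ.col ≤ (Λ γ.comp).part γ.row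

/-- The content `b − a + s_c` of a node. -/
def content (s : Fin (l + 1) → ℤ) (γ : Node l) : ℤ :=
  (γ.col : ℤ) - (γ.row : ℤ) + s γ.comp

/-- `γ` is a removable node of `Λ`. -/
def Removable (Λ : MultiPartition l) (γ : Node l) : Prop :=
  1 ≤ γ.row ∧ 1 ≤ γ.col ∧ γ.col = (Λ γ.comp).part γ.row ∧
    (Λ γ.comp).part (γ.row + 1) < (Λ γ.comp).part γ.row

/-- `γ` is an addable node of `Λ`. -/
def Addable (Λ : MultiPartition l) (γ : Node l) : Prop :=
  1 ≤ γ.row ∧ γ.col = (Λ γ.comp).part γ.row + 1 ∧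
    (γ.row = 1 ∨ (Λ γ.comp).part γ.row < (Λ γ.comp).part (γ.row - 1))

/-- The strict order `≺_s` on nodes. -/
def NodeLt (s : Fin (l + 1) → ℤ) (γ γ' : Node l) : Prop :=
  content s γ < content s γ' ∨ (content s γ = content s γ' ∧ γ'.comp < γ.comp)

inductive Letter | A | R
  deriving DecidableEq

/-- The letter attached to a node is `A` iff the node is addable, `R` iff removable. -/
def LetterOk (Λ : MultiPartition l) (p : Node l × Letter) : Prop :=
  (p.2 = Letter.A ↔ Addable Λ p.1) ∧ (p.2 = Letter.R ↔ Removable Λ p.1)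

/-- `w` is the `i`-word of `(Λ, s)` for the residue-mod-`e` structure: the list of
addable/removable nodes of residue `i`, in increasing `≺_s`-order, with letters A/R. -/
def IsWordE (Λ : MultiPartition l) (s : Fin (l + 1) → ℤ) (e : ℕ) (i : ℤ)
    (w : List (Node l × Letter)) : Prop :=
  w.Pairwise (fun p q => NodeLt s p.1 q.1) ∧
  (∀ γ : Node l, (∃ x, (γ, x) ∈ w) ↔
      ((Addable Λ γ ∨ Removable Λ γ) ∧ content s γ % (e : ℤ) = i)) ∧
  ∀ p ∈ w, LetterOk Λ p

/-- `w` is the `j`-word of `(Λ, s)` for the `e = ∞` structure: the list of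
addable/removable nodes of content `j`, in increasing `≺_s`-order, with letters A/R. -/
def IsWordInf (Λ : MultiPartition l) (s : Fin (l + 1) → ℤ) (j : ℤ)
    (w : List (Node l × Letter)) : Prop :=
  w.Pairwise (fun p q => NodeLt s p.1 q.1) ∧
  (∀ γ : Node l, (∃ x, (γ, x) ∈ w) ↔
      ((Addable Λ γ ∨ Removable Λ γ) ∧ content s γ = j)) ∧
  ∀ p ∈ w, LetterOk Λ p

/-- Recursive cancellation of all factors `RA` in a word (of nodes with letters). -/
def reduceW : List (Node l × Letter) → List (Node l × Letter)
  | [] => []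
  | p :: ps =>
    match reduceW ps with
    | [] => [p]
    | q :: qs => if p.2 = Letter.R ∧ q.2 = Letter.A then qs else p :: q :: qs

/-- `γ` is the node encoded by the rightmost `A` of the reduced word of `w`. -/
def GoodAddableWord (w : List (Node l × Letter)) (γ : Node l) : Prop :=
  ∃ u v, reduceW w = u ++ (γ, Letter.A) :: v ∧ ∀ p ∈ v, p.2 = Letter.R

/-- `γ` is the node encoded by the leftmost `R` of the reduced word of `w`. -/
def GoodRemovableWord (w : List (Node l × Letter)) (γ : Node l) : Prop :=
  ∃ u v, reduceW w = u ++ (γ, Letter.R) :: v ∧ ∀ p ∈ u, p.2 = Letter.A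

/-- `γ` is the good addable `i`-node of `(Λ, s)` for the residue-mod-`e` structure. -/
def GoodAddable (Λ : MultiPartition l) (s : Fin (l + 1) → ℤ) (e : ℕ) (i : ℤ)
    (γ : Node l) : Prop :=
  ∃ w, IsWordE Λ s e i w ∧ GoodAddableWord w γ

/-- `γ` is the good removable `i`-node of `(Λ, s)` for the residue-mod-`e` structure. -/
def GoodRemovable (Λ : MultiPartition l) (s : Fin (l + 1) → ℤ) (e : ℕ) (i : ℤ)
    (γ : Node l) : Prop :=
  ∃ w, IsWordE Λ s e i w ∧ GoodRemovableWord w γ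

/-- `γ` is the good addable `j`-node of `(Λ, s)` for the `e = ∞` structure. -/
def GoodAddableInf (Λ : MultiPartition l) (s : Fin (l + 1) → ℤ) (j : ℤ)
    (γ : Node l) : Prop :=
  ∃ w, IsWordInf Λ s j w ∧ GoodAddableWord w γ

/-- `Λ'` is obtained from `Λ` by adding the node `γ`. -/
def AddNode (Λ Λ' : MultiPartition l) (γ : Node l) : Prop :=
  (Λ' γ.comp).part γ.row = (Λ γ.comp).part γ.row + 1 ∧
  (∀ a : ℕ, a ≠ γ.row → (Λ' γ.comp).part a = (Λ γ.comp).part a) ∧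
  ∀ c, c ≠ γ.comp → Λ' c = Λ c

/-- `s ∈ S_e`: `0 ≤ s_c − s_{c'} < e` whenever `c' < c`. -/
def InSe (e : ℕ) (s : Fin (l + 1) → ℤ) : Prop :=
  ∀ c' c : Fin (l + 1), c' < c → 0 ≤ s c - s c' ∧ s c - s c' < (e : ℤ)

/-- `s ∈ D_e`: `0 ≤ s_1 ≤ … ≤ s_l < e`. -/
def InDe (e : ℕ) (s : Fin (l + 1) → ℤ) : Prop :=
  (∀ c, 0 ≤ s c ∧ s c < (e : ℤ)) ∧ Monotone s

/-- The rotation `c ↦ c + 1` of components. -/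
def rho (l : ℕ) : Equiv.Perm (Fin (l + 1)) := finRotate (l + 1)

/-- The cyclage on multicharges: `ξ(s) = (s_l − e, s_1, …, s_{l−1})`. -/
def xiCharge (e : ℕ) (s : Fin (l + 1) → ℤ) : Fin (l + 1) → ℤ :=
  fun c => s ((rho l).symm c) - if c = 0 then (e : ℤ) else 0

/-- The cyclage on multipartitions: `ξ(λ) = (λ^l, λ^1, …, λ^{l−1})`. -/
def xiMP (Λ : MultiPartition l) : MultiPartition l := fun c => Λ ((rho l).symm c)

/-- The corresponding bijection on nodes: `(a,b,c) ↦ (a,b,c+1)` cyclically. -/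
def xiNode (γ : Node l) : Node l := ⟨γ.row, γ.col, rho l γ.comp⟩

/-- The component preceding `c` (cyclically). -/
def prevComp {l : ℕ} (c : Fin (l + 1)) : Fin (l + 1) := (rho l).symm c

/-- `(Λ, s)` is cylindric. -/
def Cylindric (e : ℕ) (s : Fin (l + 1) → ℤ) (Λ : MultiPartition l) : Prop :=
  (∀ c : Fin l, ∀ a : ℕ, 1 ≤ a →
      (Λ c.succ).part (a + (s c.succ - s c.castSucc).toNat) ≤ (Λ c.castSucc).part a) ∧
  ∀ a : ℕ, 1 ≤ a →
      (Λ 0).part (a + ((e : ℤ) + s 0 - s (Fin.last l)).toNat) ≤ (Λ (Fin.last l)).part a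

/-- `γ` is the rightmost node of a part of `Λ` of size `α`. -/
def RightmostAt (Λ : MultiPartition l) (α : ℕ) (γ : Node l) : Prop :=
  1 ≤ γ.row ∧ γ.col = α ∧ (Λ γ.comp).part γ.row = α

/-- The residues of the rightmost nodes of the parts of size `α` cover `{0,…,e−1}`. -/
def Covers (e : ℕ) (s : Fin (l + 1) → ℤ) (Λ : MultiPartition l) (α : ℕ) : Prop :=
  ∀ r : ℤ, 0 ≤ r → r < (e : ℤ) →
    ∃ γ : Node l, RightmostAt Λ α γ ∧ content s γ % (e : ℤ) = r

/-- `(Λ, s)` is FLOTW. -/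
def FLOTW (e : ℕ) (s : Fin (l + 1) → ℤ) (Λ : MultiPartition l) : Prop :=
  Cylindric e s Λ ∧ ∀ α : ℕ, 1 ≤ α → ¬ Covers e s Λ α

/-- `P 0, …, P (e−1)` is the first pseudoperiod of `(Λ, s)`, of width `α`. -/
def IsFirstPseudoperiod (e : ℕ) (s : Fin (l + 1) → ℤ) (Λ : MultiPartition l)
    (α : ℕ) (P : ℕ → Node l) : Prop :=
  1 ≤ α ∧ Covers e s Λ α ∧ (∀ β : ℕ, α < β → ¬ Covers e s Λ β) ∧
  (∀ i, i < e → RightmostAt Λ α (P i)) ∧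
  (∀ γ, RightmostAt Λ α γ → content s γ ≤ content s (P 0)) ∧
  (∀ γ, RightmostAt Λ α γ → content s γ = content s (P 0) → (P 0).comp ≤ γ.comp) ∧
  ∀ i : ℕ, i + 1 < e →
    content s (P (i + 1)) < content s (P i) ∧
    (∀ γ, RightmostAt Λ α γ → content s γ < content s (P i) →
        content s γ ≤ content s (P (i + 1))) ∧
    ∀ γ, RightmostAt Λ α γ → content s γ = content s (P (i + 1)) →
        (P (i + 1)).comp ≤ γ.comp

/-- `γ` is one of the nodes of the pseudoperiod `P` (of length `e`). -/
def InPseudo (e : ℕ) (P : ℕ → Node l) (γ : Node l) : Prop := ∃ i, i < e ∧ P i = γ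

/-- The number of parts of `π` equal to `v`. -/
noncomputable def countParts (π : Partition) (v : ℕ) : ℕ :=
  Nat.card {a : ℕ // 1 ≤ a ∧ π.part a = v}

/-- `N^{>α}_c`: the number of parts of `Λ^c` greater than `α`. -/
noncomputable def NgtA (Λ : MultiPartition l) (α : ℕ) (c : Fin (l + 1)) : ℕ :=
  Nat.card {a : ℕ // 1 ≤ a ∧ α < (Λ c).part a}

/-- `N^α_c`: the number of parts of `Λ^c` (equal to `α`) whose rightmost node is in `P`. -/
noncomputable def NalP (e : ℕ) (P : ℕ → Node l) (c : Fin (l + 1)) : ℕ :=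
  Nat.card {i : ℕ // i < e ∧ (P i).comp = c}

/-- The number of rows of component `c` above row `r` whose rightmost node is in `P`. -/
noncomputable def PAbove (e : ℕ) (P : ℕ → Node l) (c : Fin (l + 1)) (r : ℕ) : ℕ :=
  Nat.card {i : ℕ // i < e ∧ (P i).comp = c ∧ (P i).row < r}

/-- `μ = ψ(Λ)`: for each component `C`, `μ^C` consists of the parts of `Λ^C` smaller
than `α`, the parts of `Λ^C` equal to `α` whose rightmost node is not in `P`, and the
parts of `Λ^{C−1}` (cyclically) greater than `α`; specified via part multiplicities. -/
def IsPsi (e : ℕ) (P : ℕ → Node l) (α : ℕ) (Λ μ : MultiPartition l) : Prop :=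
  ∀ C : Fin (l + 1), ∀ v : ℕ, 1 ≤ v →
    countParts (μ C) v =
      if v < α then countParts (Λ C) v
      else if v = α then countParts (Λ C) α - NalP e P C
      else countParts (Λ (prevComp C)) v

/-- The canonical association between nodes of `Λ` (outside the rows of `P`) and
nodes of `ψ(Λ)`: boxes of parts `> α` keep their row and move one component up
(cyclically), boxes of kept parts `≤ α` stay in their component, their row being
shifted by the number of rows removed above minus the number of rows inserted above. -/
def CanonAssoc (e : ℕ) (Λ : MultiPartition l) (α : ℕ) (P : ℕ → Node l)
    (γ Γ : Node l) : Prop :=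
  Γ.col = γ.col ∧
  ( (α < (Λ γ.comp).part γ.row ∧ Γ.comp = rho l γ.comp ∧ Γ.row = γ.row)
  ∨ ((Λ γ.comp).part γ.row ≤ α ∧
      (∀ i, i < e → ¬ ((P i).comp = γ.comp ∧ (P i).row = γ.row)) ∧
      Γ.comp = γ.comp ∧
      Γ.row + NgtA Λ α γ.comp + PAbove e P γ.comp γ.row
        = γ.row + NgtA Λ α (prevComp γ.comp)) )

/-- The entry of the `s`-symbol of `Λ` of size `p` in row `c` and column `k`
(`1 ≤ k ≤ p + s_c`): `b^c_a = λ^c_a − a + p + s_c` with `a = p + s_c − k + 1`. -/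
def symbolEntry (s : Fin (l + 1) → ℤ) (Λ : MultiPartition l) (p : ℤ)
    (c : Fin (l + 1)) (k : ℕ) : ℤ :=
  ((Λ c).part (p + s c - (k : ℤ) + 1).toNat : ℤ) - (p + s c - (k : ℤ) + 1) + p + s c

/-- `p` is an admissible size for the `s`-symbol of `Λ`:
`p ≥ 1 − s_c + h(λ^c)` for all `c`. -/
def SizeOK (s : Fin (l + 1) → ℤ) (Λ : MultiPartition l) (p : ℤ) : Prop :=
  ∀ c, 1 ≤ p + s c ∧ ∀ a : ℕ, p + s c ≤ (a : ℤ) → (Λ c).part a = 0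

/-- The `s`-symbol of `Λ` of size `p` is semistandard: `s` is non-decreasing, the
entries in each column are non-decreasing (read from the row with the larger index
down to the row with the smaller one), and the entries in each row are increasing. -/
def SemistandardAt (s : Fin (l + 1) → ℤ) (Λ : MultiPartition l) (p : ℤ) : Prop :=
  Monotone s ∧
  (∀ c c' : Fin (l + 1), c < c' → ∀ k : ℕ, 1 ≤ k → (k : ℤ) ≤ p + s c →
      symbolEntry s Λ p c' k ≤ symbolEntry s Λ p c k) ∧
  ∀ c, ∀ k : ℕ, 1 ≤ k → (k : ℤ) + 1 ≤ p + s c →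
      symbolEntry s Λ p c k < symbolEntry s Λ p c (k + 1)

/-- The `s`-symbol of `Λ` is semistandard (for every admissible size). -/
def Semistandard (s : Fin (l + 1) → ℤ) (Λ : MultiPartition l) : Prop :=
  ∀ p : ℤ, SizeOK s Λ p → SemistandardAt s Λ p

/-- The index of the column of the symbol of size `p` containing the entry
corresponding to the node `γ`. -/
def colOf (s : Fin (l + 1) → ℤ) (p : ℤ) (γ : Node l) : ℤ :=
  p + s γ.comp - (γ.row : ℤ) + 1

theorem Partition.part_le_part (π : Partition) {a b : ℕ} (ha : 1 ≤ a) (hab : a ≤ b) :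
    π.part b ≤ π.part a := by
  induction b, hab using Nat.le_induction with
  | base => exact le_rfl
  | succ n hn ih => exact (π.antitone n (ha.trans hn)).trans ih

/-- Inequalities between the parts of different components which express semistandardness. -/
def ColumnCondition (s : Fin (l + 1) → ℤ) (Λ : MultiPartition l) : Prop :=
  ∀ c c' : Fin (l + 1), c < c' → ∀ a a' : ℕ, 1 ≤ a → (a' : ℤ) - s c' = a - s c →
    (Λ c').part a' ≤ (Λ c).part a

theorem exists_sizeOK (s : Fin (l + 1) → ℤ) (Λ : MultiPartition l) (m : ℤ) :
    ∃ p, m ≤ p ∧ SizeOK s Λ p := by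
  choose N hN using fun c => (Λ c).eventually_zero
  obtain ⟨M, hM⟩ := (Set.finite_range fun c => (N c : ℤ) + 1 - s c).bddAbove
  have hM' (c : Fin (l + 1)) : (N c : ℤ) + 1 - s c ≤ M := hM ⟨c, rfl⟩
  refine ⟨max m M, le_max_left _ _, fun c => ⟨?_, fun a ha => hN c a ?_⟩⟩
  all_goals
    have := hM' c
    have := le_max_right m M
    omega

theorem semistandard_iff_columnCondition {s : Fin (l + 1) → ℤ} (hs : Monotone s)
    (Λ : MultiPartition l) : Semistandard s Λ ↔ ColumnCondition s Λ := by
  constructor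
  · intro h c c' hc a a' ha haa'
    obtain ⟨p, hp, hsize⟩ := exists_sizeOK s Λ (a - s c)
    have hcol := (h p hsize).2.1 c c' hc (p + s c - a + 1).toNat (by omega) (by omega)
    unfold symbolEntry at hcol
    have h₁ : (p + s c - ((p + s c - a + 1).toNat : ℤ) + 1).toNat = a := by omega
    have h₂ : (p + s c' - ((p + s c - a + 1).toNat : ℤ) + 1).toNat = a' := by omega
    rw [h₁, h₂] at hcol
    omega
  · intro h p _
    refine ⟨hs, fun c c' hc k _ hk => ?_, fun c k _ hk => ?_⟩
    · have := hs hc.le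
      have := h c c' hc (p + s c - k + 1).toNat (p + s c' - k + 1).toNat (by omega) (by omega)
      unfold symbolEntry
      omega
    · have := (Λ c).part_le_part (a := (p + s c - (k + 1 : ℕ) + 1).toNat)
        (b := (p + s c - k + 1).toNat) (by omega) (by omega)
      unfold symbolEntry
      omega

theorem NodeLt.asymm {s : Fin (l + 1) → ℤ} {γ δ : Node l} (h : NodeLt s γ δ) :
    ¬ NodeLt s δ γ := by
  rintro (h' | ⟨h', h''⟩) <;> rcases h with h | ⟨h, h₁⟩
  · omega
  · omega
  · omega
  · exact lt_asymm h₁ h''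

theorem NodeLt.between {s : Fin (l + 1) → ℤ} {γ q δ : Node l} (h₁ : NodeLt s γ q)
    (h₂ : NodeLt s q δ) (h : content s γ = content s δ) :
    content s q = content s γ ∧ δ.comp < q.comp ∧ q.comp < γ.comp := by
  rcases h₁ with h₁ | ⟨h₁, h₁'⟩ <;> rcases h₂ with h₂ | ⟨h₂, h₂'⟩
  · omega
  · omega
  · omega
  · exact ⟨h₁.symm, h₂', h₁'⟩

theorem not_removable_of_part {s : Fin (l + 1) → ℤ} {Λ : MultiPartition l} {q : Node l} {a : ℕ}
    (ha : 1 ≤ a) (hq : content s q = (Λ q.comp).part a + 1 - a + s q.comp) :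
    ¬ Removable Λ q := by
  rintro ⟨hrow, _, hcol, hlt⟩
  unfold content at hq
  rcases le_or_gt a q.row with h | h
  · have := (Λ q.comp).part_le_part ha h
    omega
  · have := (Λ q.comp).part_le_part (a := q.row + 1) (by omega) h
    omega

theorem not_addable_of_part {s : Fin (l + 1) → ℤ} {Λ : MultiPartition l} {q : Node l} {a : ℕ}
    (ha : 1 ≤ a) (hq : content s q = (Λ q.comp).part a - a + s q.comp) :
    ¬ Addable Λ q := by
  rintro ⟨hrow, hcol, hlt⟩
  unfold content at hq
  rcases le_or_gt q.row a with h | h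
  · have := (Λ q.comp).part_le_part hrow h
    omega
  · have := (Λ q.comp).part_le_part (b := q.row - 1) ha (by omega)
    omega

/-- A column entry lying between two equal entries is equal to them. -/
theorem ColumnCondition.exists_part_eq {s : Fin (l + 1) → ℤ} {Λ : MultiPartition l}
    (h : ColumnCondition s Λ) (hs : Monotone s) {c d c' : Fin (l + 1)} (hcd : c < d)
    (hdc : d < c') {a a' : ℕ} (ha : 1 ≤ a) (haa' : (a' : ℤ) - s c' = a - s c)
    (heq : (Λ c').part a' = (Λ c).part a) :
    ∃ b : ℕ, 1 ≤ b ∧ (b : ℤ) - s d = a - s c ∧ (Λ d).part b = (Λ c).part a := by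
  have := hs hcd.le
  have hb : (((a : ℤ) + s d - s c).toNat : ℤ) - s d = a - s c := by omega
  have h₁ : 1 ≤ ((a : ℤ) + s d - s c).toNat := by omega
  refine ⟨_, h₁, hb, le_antisymm (h c d hcd _ _ ha hb) ?_⟩
  rw [← heq]
  exact h d c' hdc _ _ h₁ (by omega)

theorem reduceW_sublist (w : List (Node l × Letter)) : (reduceW w).Sublist w := by
  induction w with
  | nil => simp [reduceW]
  | cons p ps ih =>
    rw [reduceW]
    split
    · simp
    · next q qs hq =>
      rw [hq] at ih
      split
      · exact ((List.sublist_cons_self q qs).trans ih).trans (List.sublist_cons_self p ps)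
      · exact ih.cons_cons p

theorem reduceW_cons_A (γ : Node l) (w : List (Node l × Letter)) :
    reduceW ((γ, Letter.A) :: w) = (γ, Letter.A) :: reduceW w := by
  rw [reduceW]
  split <;> simp_all

theorem reduceW_append_of_A {u : List (Node l × Letter)} (hu : ∀ p ∈ u, p.2 = Letter.A)
    (w : List (Node l × Letter)) : reduceW (u ++ w) = u ++ reduceW w := by
  induction u with
  | nil => rfl
  | cons p ps ih =>
    obtain ⟨γ, x⟩ := p
    obtain rfl : x = Letter.A := hu _ List.mem_cons_self
    rw [List.cons_append, reduceW_cons_A, ih fun p hp => hu p (List.mem_cons_of_mem _ hp)]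
    rfl

theorem reduceW_append_of_R {u : List (Node l × Letter)} (hu : ∀ p ∈ u, p.2 = Letter.R)
    {w : List (Node l × Letter)} {q : Node l × Letter} {z : List (Node l × Letter)}
    (hw : reduceW w = q :: z) (hq : q.2 = Letter.R) : reduceW (u ++ w) = u ++ reduceW w := by
  induction u with
  | nil => rfl
  | cons p ps ih =>
    have ih := ih fun p hp => hu p (List.mem_cons_of_mem _ hp)
    rw [List.cons_append, reduceW, ih, hw]
    cases ps with
    | nil => simp [hq]
    | cons r rs => simp [hu r (by simp)]

theorem reduceW_append_suffix (u x : List (Node l × Letter)) :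
    ∃ u' t, reduceW (u ++ x) = u' ++ t ∧ u'.Sublist u ∧ t <:+ reduceW x := by
  induction u with
  | nil => exact ⟨[], _, rfl, List.Sublist.refl _, List.suffix_refl _⟩
  | cons p ps ih =>
    obtain ⟨u', t, h, hu', ht⟩ := ih
    rw [List.cons_append, reduceW]
    split
    · exact ⟨[p], [], rfl, by simp, List.nil_suffix⟩
    · next q qs hq =>
      split
      · cases u' with
        | nil =>
          obtain rfl : q :: qs = t := by rw [← hq, h]; rfl
          exact ⟨[], qs, rfl, List.nil_sublist _, (List.suffix_cons q qs).trans ht⟩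
        | cons r rs =>
          rw [h, List.cons_append, List.cons.injEq] at hq
          exact ⟨rs, t, hq.2.symm,
            ((List.sublist_cons_self r rs).trans hu').trans (List.sublist_cons_self p ps), ht⟩
      · exact ⟨p :: u', t, by rw [← hq, h]; rfl, hu'.cons_cons p, ht⟩

theorem reduceW_append_of_head_R (u : List (Node l × Letter)) {x : List (Node l × Letter)}
    {q : Node l × Letter} {z : List (Node l × Letter)} (hx : reduceW x = q :: z)
    (hq : q.2 = Letter.R) : ∃ u', reduceW (u ++ x) = u' ++ q :: z := by
  induction u with
  | nil => exact ⟨[], hx⟩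
  | cons p ps ih =>
    obtain ⟨u', h⟩ := ih
    rw [List.cons_append, reduceW, h]
    cases u' with
    | nil => exact ⟨[p], by simp [hq]⟩
    | cons r rs =>
      simp only [List.cons_append]
      split
      · exact ⟨rs, rfl⟩
      · exact ⟨p :: r :: rs, rfl⟩

theorem exists_factorization_of_nodeLt {s : Fin (l + 1) → ℤ} {w : List (Node l × Letter)}
    (hw : w.Pairwise (fun p q => NodeLt s p.1 q.1)) {p q : Node l × Letter} (hp : p ∈ w)
    (hq : q ∈ w) (hpq : NodeLt s p.1 q.1) :
    ∃ w₁ m w₂, w = w₁ ++ p :: (m ++ q :: w₂) ∧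
      ∀ r ∈ m, NodeLt s p.1 r.1 ∧ NodeLt s r.1 q.1 := by
  obtain ⟨w₁, w', rfl⟩ := List.append_of_mem hp
  rw [List.pairwise_append, List.pairwise_cons] at hw
  obtain ⟨-, ⟨hpw, hw'⟩, hcross⟩ := hw
  have hq' : q ∈ w' := by
    rcases List.mem_append.1 hq with h | h
    · exact absurd (hcross q h p List.mem_cons_self) hpq.asymm
    · rcases List.mem_cons.1 h with rfl | h
      · exact absurd hpq hpq.asymm
      · exact h
  obtain ⟨m, w₂, rfl⟩ := List.append_of_mem hq'
  rw [List.pairwise_append] at hw'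
  exact ⟨w₁, m, w₂, rfl, fun r hr =>
    ⟨hpw r (List.mem_append_left _ hr), hw'.2.2 r hr q List.mem_cons_self⟩⟩

/-- An `A` to the right of the good addable node is preceded by an `R` lying between them. -/
theorem GoodAddableWord.exists_R_between {s : Fin (l + 1) → ℤ} {w : List (Node l × Letter)}
    (hw : w.Pairwise (fun p q => NodeLt s p.1 q.1)) {γ δ : Node l} (hγ : GoodAddableWord w γ)
    (hδ : (δ, Letter.A) ∈ w) (hγδ : NodeLt s γ δ) :
    ∃ q, (q, Letter.R) ∈ w ∧ NodeLt s γ q ∧ NodeLt s q δ := by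
  obtain ⟨u, v, huv, hv⟩ := hγ
  have hmem : (γ, Letter.A) ∈ reduceW w := by simp [huv]
  have hred : (reduceW w).Pairwise (fun p q => NodeLt s p.1 q.1) := hw.sublist (reduceW_sublist w)
  obtain ⟨w₁, m, w₂, rfl, hm⟩ :=
    exists_factorization_of_nodeLt hw ((reduceW_sublist w).subset hmem) hδ hγδ
  by_contra! hno
  have hmA : ∀ p ∈ m, p.2 = Letter.A := by
    rintro ⟨q, _ | _⟩ hq
    · rfl
    · exact absurd (hm _ hq).2 (hno q (by simp [hq]) (hm _ hq).1)
  obtain ⟨u', t, ht, hu', hsuff⟩ :=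
    reduceW_append_suffix w₁ ((γ, Letter.A) :: (m ++ (δ, Letter.A) :: w₂))
  have hall := hw
  rw [List.pairwise_append, List.pairwise_cons] at hall
  have htail : reduceW ((γ, Letter.A) :: (m ++ (δ, Letter.A) :: w₂)) =
      (γ, Letter.A) :: (m ++ (δ, Letter.A) :: reduceW w₂) := by
    rw [reduceW_cons_A, reduceW_append_of_A hmA, reduceW_cons_A]
  have hsub : (m ++ (δ, Letter.A) :: reduceW w₂).Sublist (m ++ (δ, Letter.A) :: w₂) :=
    ((reduceW_sublist w₂).cons_cons _).append_left m
  have hγt : (γ, Letter.A) ∈ t := by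
    rw [ht] at hmem
    rcases List.mem_append.1 hmem with h | h
    · have := hall.2.2 _ (hu'.subset h) _ List.mem_cons_self
      exact absurd this this.asymm
    · exact h
  have hδt : (δ, Letter.A) ∈ t := by
    rw [htail, List.suffix_cons_iff] at hsuff
    rcases hsuff with rfl | h
    · simp
    · have := hall.2.1.1 _ (hsub.subset (h.subset hγt))
      exact absurd this this.asymm
  have hδr : (δ, Letter.A) ∈ u ++ (γ, Letter.A) :: v := by
    rw [← huv, ht]
    exact List.mem_append_right _ hδt
  rw [huv, List.pairwise_append] at hred
  rcases List.mem_append.1 hδr with h | h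
  · exact hγδ.asymm (hred.2.2 _ h _ List.mem_cons_self)
  · rcases List.mem_cons.1 h with h | h
    · obtain rfl : δ = γ := congrArg Prod.fst h
      exact hγδ.asymm hγδ
    · cases hv _ h

/-- An `R` to the left of the good removable node is followed by an `A` lying between them. -/
theorem GoodRemovableWord.exists_A_between {s : Fin (l + 1) → ℤ} {w : List (Node l × Letter)}
    (hw : w.Pairwise (fun p q => NodeLt s p.1 q.1)) {γ δ : Node l} (hγ : GoodRemovableWord w γ)
    (hδ : (δ, Letter.R) ∈ w) (hδγ : NodeLt s δ γ) :
    ∃ q, (q, Letter.A) ∈ w ∧ NodeLt s δ q ∧ NodeLt s q γ := by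
  obtain ⟨u, v, huv, hu⟩ := hγ
  have hmem : (γ, Letter.R) ∈ reduceW w := by simp [huv]
  have hred : (reduceW w).Pairwise (fun p q => NodeLt s p.1 q.1) := hw.sublist (reduceW_sublist w)
  obtain ⟨w₁, m, w₂, rfl, hm⟩ :=
    exists_factorization_of_nodeLt hw hδ ((reduceW_sublist w).subset hmem) hδγ
  by_contra! hno
  have hmR : ∀ p ∈ (δ, Letter.R) :: m, p.2 = Letter.R := by
    rintro ⟨q, _ | _⟩ hq
    · rcases List.mem_cons.1 hq with h | hq
      · cases h
      · exact absurd (hm _ hq).2 (hno q (by simp [hq]) (hm _ hq).1)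
    · rfl
  have hassoc : w₁ ++ (δ, Letter.R) :: (m ++ (γ, Letter.R) :: w₂) =
      (w₁ ++ (δ, Letter.R) :: m) ++ (γ, Letter.R) :: w₂ := by simp
  obtain ⟨u', t, ht, hu', hsuff⟩ :=
    reduceW_append_suffix (w₁ ++ (δ, Letter.R) :: m) ((γ, Letter.R) :: w₂)
  have hall := hw
  rw [hassoc, List.pairwise_append, List.pairwise_cons] at hall
  have hγt : (γ, Letter.R) ∈ t := by
    rw [hassoc, ht] at hmem
    rcases List.mem_append.1 hmem with h | h
    · have := hall.2.2 _ (hu'.subset h) _ List.mem_cons_self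
      exact absurd this this.asymm
    · exact h
  have hγx : ∃ z, reduceW ((γ, Letter.R) :: w₂) = (γ, Letter.R) :: z := by
    have hnot : (γ, Letter.R) ∉ reduceW w₂ := fun h => by
      have := hall.2.1.1 _ ((reduceW_sublist w₂).subset h)
      exact this.asymm this
    have hin := hsuff.subset hγt
    rw [reduceW] at hin ⊢
    split at hin
    · exact ⟨_, rfl⟩
    · next q qs hq =>
      split at hin
      · exact absurd (hq ▸ List.mem_cons_of_mem _ hin) hnot
      · next hc => exact ⟨_, if_neg hc⟩
  obtain ⟨z, hz⟩ := hγx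
  have hx : reduceW ((δ, Letter.R) :: (m ++ (γ, Letter.R) :: w₂)) =
      (δ, Letter.R) :: (m ++ (γ, Letter.R) :: z) := by
    have := reduceW_append_of_R hmR hz rfl
    rwa [hz] at this
  obtain ⟨u'', hu''⟩ := reduceW_append_of_head_R w₁ hx rfl
  have hδr : (δ, Letter.R) ∈ u ++ (γ, Letter.R) :: v := by
    rw [← huv, hu'']
    simp
  rw [huv, List.pairwise_append, List.pairwise_cons] at hred
  rcases List.mem_append.1 hδr with h | h
  · cases hu _ h
  · rcases List.mem_cons.1 h with h | h
    · obtain rfl : δ = γ := congrArg Prod.fst h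
      exact hδγ.asymm hδγ
    · exact hδγ.asymm (hred.2.1.1 _ h)

theorem AddNode.part_of_ne {Λ Λ' : MultiPartition l} {γ : Node l} (h : AddNode Λ Λ' γ)
    {c : Fin (l + 1)} {a : ℕ} (hne : ¬ (c = γ.comp ∧ a = γ.row)) :
    (Λ' c).part a = (Λ c).part a := by
  by_cases hc : c = γ.comp
  · subst hc
    exact h.2.1 a fun ha => hne ⟨rfl, ha⟩
  · rw [h.2.2 c hc]

theorem ColumnCondition.addNode {s : Fin (l + 1) → ℤ} (hs : Monotone s)
    {Λ Λ' : MultiPartition l} (h : ColumnCondition s Λ) {e : ℕ} {i : ℤ} {γ : Node l}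
    (hγ : GoodAddable Λ s e i γ) (hadd : AddNode Λ Λ' γ) : ColumnCondition s Λ' := by
  obtain ⟨w, ⟨hpw, hnodes, hletters⟩, hgood⟩ := hγ
  have hγw : (γ, Letter.A) ∈ w := by
    obtain ⟨u, v, huv, -⟩ := hgood
    exact (reduceW_sublist w).subset (by simp [huv])
  have hγadd : Addable Λ γ := (hletters _ hγw).1.1 rfl
  have hγres := ((hnodes γ).1 ⟨_, hγw⟩).2
  intro c c' hc a a' ha haa'
  have hle := h c c' hc a a' ha haa'
  by_cases h' : c' = γ.comp ∧ a' = γ.row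
  swap
  · rw [hadd.part_of_ne h']
    by_cases h'' : c = γ.comp ∧ a = γ.row
    · obtain ⟨rfl, rfl⟩ := h''
      have := hadd.1
      omega
    · rwa [hadd.part_of_ne h'']
  obtain ⟨rfl, rfl⟩ := h'
  rw [hadd.1, hadd.part_of_ne (fun h => hc.ne h.1)]
  by_contra hlt
  have heq : (Λ γ.comp).part γ.row = (Λ c).part a := by omega
  have hsc := hs hc.le
  obtain ⟨hrow, hcol, hcorner⟩ := hγadd
  have hδadd : Addable Λ ⟨a, (Λ c).part a + 1, c⟩ := by
    refine ⟨ha, rfl, ?_⟩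
    rcases Nat.eq_or_lt_of_le ha with h1 | h1
    · exact Or.inl h1.symm
    · have := h c γ.comp hc (a - 1) (γ.row - 1) (by omega) (by omega)
      exact Or.inr (by dsimp only; omega)
  have hcont : content s γ = content s ⟨a, (Λ c).part a + 1, c⟩ := by
    simp only [content]
    omega
  obtain ⟨x, hx⟩ := (hnodes ⟨a, (Λ c).part a + 1, c⟩).2 ⟨Or.inl hδadd, hcont ▸ hγres⟩
  obtain rfl : x = Letter.A := (hletters _ hx).1.2 hδadd
  obtain ⟨q, hq, hγq, hqδ⟩ := hgood.exists_R_between hpw hx (Or.inr ⟨hcont, hc⟩)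
  obtain ⟨hqc, hcq, hqγ⟩ := hγq.between hqδ hcont
  obtain ⟨b, hb, hbs, hbp⟩ := h.exists_part_eq hs hcq hqγ ha haa' heq
  refine not_removable_of_part (s := s) hb ?_ ((hletters _ hq).2.1 rfl)
  rw [hqc, hcont]
  simp only [content]
  dsimp only at hbs hbp
  omega

theorem ColumnCondition.removeNode {s : Fin (l + 1) → ℤ} (hs : Monotone s)
    {Λ Λ' : MultiPartition l} (h : ColumnCondition s Λ) {e : ℕ} {i : ℤ} {γ : Node l}
    (hγ : GoodRemovable Λ s e i γ) (hadd : AddNode Λ' Λ γ) : ColumnCondition s Λ' := by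
  obtain ⟨w, ⟨hpw, hnodes, hletters⟩, hgood⟩ := hγ
  have hγw : (γ, Letter.R) ∈ w := by
    obtain ⟨u, v, huv, -⟩ := hgood
    exact (reduceW_sublist w).subset (by simp [huv])
  have hγrem : Removable Λ γ := (hletters _ hγw).2.1 rfl
  have hγres := ((hnodes γ).1 ⟨_, hγw⟩).2
  intro c c' hc a a' ha haa'
  have hle := h c c' hc a a' ha haa'
  by_cases h' : c = γ.comp ∧ a = γ.row
  swap
  · rw [← hadd.part_of_ne h']
    by_cases h'' : c' = γ.comp ∧ a' = γ.row
    · obtain ⟨rfl, rfl⟩ := h''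
      have := hadd.1
      omega
    · rwa [← hadd.part_of_ne h'']
  obtain ⟨rfl, rfl⟩ := h'
  rw [← hadd.part_of_ne (fun h => hc.ne' h.1)]
  by_contra hlt
  have hrowadd := hadd.1
  have heq : (Λ c').part a' = (Λ γ.comp).part γ.row := by omega
  have hsc := hs hc.le
  obtain ⟨hrow, hcol, hcol', hcorner⟩ := hγrem
  have hδrem : Removable Λ ⟨a', (Λ c').part a', c'⟩ := by
    have := h γ.comp c' hc (γ.row + 1) (a' + 1) (by omega) (by omega)
    refine ⟨?_, ?_, rfl, ?_⟩ <;> dsimp only <;> omega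
  have hcont : content s ⟨a', (Λ c').part a', c'⟩ = content s γ := by
    simp only [content]
    omega
  obtain ⟨x, hx⟩ := (hnodes ⟨a', (Λ c').part a', c'⟩).2 ⟨Or.inr hδrem, hcont ▸ hγres⟩
  obtain rfl : x = Letter.R := (hletters _ hx).2.2 hδrem
  obtain ⟨q, hq, hδq, hqγ⟩ := hgood.exists_A_between hpw hx (Or.inr ⟨hcont, hc⟩)
  obtain ⟨hqc, hcq, hqδ⟩ := hδq.between hqγ hcont
  obtain ⟨b, hb, hbs, hbp⟩ := h.exists_part_eq hs hcq hqδ ha haa' heq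
  refine not_addable_of_part (s := s) hb ?_ ((hletters _ hq).1.1 rfl)
  rw [hqc, hcont]
  simp only [content]
  omega

/-!
STATEMENT 7: if s_1 ≤ … ≤ s_l and the s-symbol of λ is semistandard, then the s-symbol
of the multipartition obtained by adding the good addable i-node (resp. removing the
good removable i-node) is again semistandard.
-/
theorem semistandard_stable_under_crystal_operators
    (l e : ℕ) (he : 2 ≤ e) (s : Fin (l + 1) → ℤ) (Λ : MultiPartition l)
    (hmono : Monotone s) (hss : Semistandard s Λ) (i : ℕ) (hi : i < e) :
    (∀ (γ : Node l) (Λ' : MultiPartition l),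
        GoodAddable Λ s e (i : ℤ) γ → AddNode Λ Λ' γ → Semistandard s Λ') ∧
    (∀ (γ : Node l) (Λ' : MultiPartition l),
        GoodRemovable Λ s e (i : ℤ) γ → AddNode Λ' Λ γ → Semistandard s Λ') := by
  have h := (semistandard_iff_columnCondition hmono Λ).1 hss
  exact ⟨fun γ Λ' hγ hadd => (semistandard_iff_columnCondition hmono Λ').2 (h.addNode hmono hγ hadd),
    fun γ Λ' hγ hadd => (semistandard_iff_columnCondition hmono Λ').2 (h.removeNode hmono hγ hadd)⟩

end FockCrystal
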